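/- arXiv:1711.01193 — 4 statements merged into one kernel-verified Lean document; each statement's English description precedes it below -/
import Mathlib

section
/- For any probability vectors p and q of dimension d, the maximum of the fidelity F(p, p̃) over all probability vectors p̃ of dimension d that majorise q equals the maximum of the fidelity F(q, q̃) over all probability vectors q̃ of dimension d that are majorised by p; i.e. max_{p̃ : p̃ ≻ q} F(p, p̃) = max_{q̃ : p ≻ q̃} F(q, q̃) (both maxima are attained). -/
open Finset Filter

noncomputable section

/-- A probability vector: nonnegative entries summing to 1. -/
def IsProbVec {ι : Type*} [Fintype ι] (p : ι → ℝ) : Prop :=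
  (∀ i, 0 ≤ p i) ∧ ∑ i, p i = 1

/-- The sum of the `k` largest entries of `p`: the largest sum over subsets of at
most `k` indices (for nonnegative vectors this equals the sorted partial sum,
with zero padding beyond the dimension). -/
def kMaxSum {ι : Type*} [Fintype ι] (p : ι → ℝ) (k : ℕ) : ℝ :=
  (Finset.univ.powerset.filter (fun s : Finset ι => s.card ≤ k)).sup'
    ⟨∅, by simp⟩ (fun s => ∑ i ∈ s, p i)

/-- `p ≻ q`: for every `k`, the sum of the `k` largest entries of `p` is at least
that of `q` (dimensions may differ, the shorter padded with zeros). -/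
def Majorises {ι κ : Type*} [Fintype ι] [Fintype κ] (p : ι → ℝ) (q : κ → ℝ) : Prop :=
  ∀ k : ℕ, kMaxSum q k ≤ kMaxSum p k

/-- Fidelity `F(p,q) = (Σ_i √(p_i q_i))²`. -/
def fidelity {ι : Type*} [Fintype ι] (p q : ι → ℝ) : ℝ :=
  (∑ i, Real.sqrt (p i * q i)) ^ 2

/-- Infidelity `δ(p,q) = 1 - F(p,q)`. -/
def infid {ι : Type*} [Fintype ι] (p q : ι → ℝ) : ℝ := 1 - fidelity p q

/-- Summation by parts: pairing with a nonnegative antitone weight preserves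
an inequality between partial sums. -/
theorem sum_mul_le_sum_mul_of_antitone {h a b : ℕ → ℝ} (hh : Antitone h) (h0 : ∀ i, 0 ≤ h i)
    (n : ℕ) (hab : ∀ j ≤ n, ∑ i ∈ range j, a i ≤ ∑ i ∈ range j, b i) :
    ∑ i ∈ range n, h i * a i ≤ ∑ i ∈ range n, h i * b i := by
  have key : ∀ j ≤ n, h j * (∑ i ∈ range j, b i - ∑ i ∈ range j, a i) ≤
      ∑ i ∈ range j, h i * b i - ∑ i ∈ range j, h i * a i := by
    intro j
    induction j with
    | zero => simp
    | succ j ih =>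
      intro hj
      have h1 := ih (by omega)
      have h2 := hab (j + 1) hj
      have h3 := hh (Nat.le_succ j)
      simp only [sum_range_succ] at *
      nlinarith [mul_nonneg (sub_nonneg.2 h3) (sub_nonneg.2 h2)]
  have h1 := key n le_rfl
  have h2 := mul_nonneg (h0 n) (sub_nonneg.2 (hab n le_rfl))
  linarith

/-- The slopes `r` of the greatest convex minorant of the points `(∑ i < j, q i, ∑ i < j, p i)`,
and its increments `x`. -/
theorem exists_convex_minorant (n : ℕ) : ∀ (p q : ℕ → ℝ) (R : ℝ), Antitone p → Antitone q →
    (∀ i, 0 ≤ p i) → (∀ i, 0 ≤ q i) → 0 ≤ R →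
    (∀ j ≤ n, ∑ i ∈ range j, q i ≤ R * ∑ i ∈ range j, p i) →
    ∃ r x : ℕ → ℝ, Antitone r ∧ (∀ i, 0 ≤ r i) ∧ (∀ i, r i ≤ R) ∧
      Antitone x ∧ (∀ i, 0 ≤ x i) ∧ x 0 ≤ p 0 ∧ (∀ i < n, r i * x i = q i) ∧
      (∀ j ≤ n, ∑ i ∈ range j, x i ≤ ∑ i ∈ range j, p i) ∧
      (∀ j ≤ n, ∑ i ∈ range j, q i ≤ ∑ i ∈ range j, r i * p i) ∧
      (∀ g : ℝ → ℝ, ∑ i ∈ range n, g (r i) * x i = ∑ i ∈ range n, g (r i) * p i) := by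
  induction n using Nat.strong_induction_on with
  | _ n ih =>
  intro p q R hp hq hp0 hq0 hR hqp
  by_cases hQ : ∑ i ∈ range n, q i = 0
  · have hz : ∀ i < n, q i = 0 := fun i hi =>
      (sum_eq_zero_iff_of_nonneg fun i _ => hq0 i).1 hQ i (mem_range.2 hi)
    refine ⟨fun _ => 0, p, antitone_const, fun _ => le_rfl, fun _ => hR, hp, hp0, le_rfl,
      fun i hi => by simp [hz i hi], fun _ _ => le_rfl, fun j hj => ?_, fun _ => rfl⟩
    rw [sum_eq_zero fun i hi => hz i (by have := mem_range.1 hi; omega)]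
    simp
  have hP0 : ∀ j, 0 ≤ ∑ i ∈ range j, p i := fun j => sum_nonneg fun i _ => hp0 i
  have hQ0 : ∀ j, 0 ≤ ∑ i ∈ range j, q i := fun j => sum_nonneg fun i _ => hq0 i
  have hQn : 0 < ∑ i ∈ range n, q i := lt_of_le_of_ne (hQ0 n) (Ne.symm hQ)
  have hPn : 0 < ∑ i ∈ range n, p i := by
    refine lt_of_le_of_ne (hP0 n) fun h => ?_
    have := hqp n le_rfl
    rw [← h] at this
    linarith
  obtain ⟨k, hk, hmax⟩ := exists_max_image (range (n + 1))
    (fun j => (∑ i ∈ range j, q i) / ∑ i ∈ range j, p i) ⟨0, by simp⟩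
  have hkn : k ≤ n := by have := mem_range.1 hk; omega
  set ρ := (∑ i ∈ range k, q i) / ∑ i ∈ range k, p i with hρ
  have hρ0 : 0 < ρ := lt_of_lt_of_le (div_pos hQn hPn) (hmax n (by simp))
  have hQk : 0 < ∑ i ∈ range k, q i :=
    lt_of_le_of_ne (hQ0 k) fun h => by rw [hρ, ← h, zero_div] at hρ0; exact lt_irrefl _ hρ0
  have hPk : 0 < ∑ i ∈ range k, p i :=
    lt_of_le_of_ne (hP0 k) fun h => by rw [hρ, ← h, div_zero] at hρ0; exact lt_irrefl _ hρ0
  have hk0 : 0 < k := Nat.pos_of_ne_zero fun h => by simp [h] at hQk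
  have hle : ∀ j ≤ n, ∑ i ∈ range j, q i ≤ ρ * ∑ i ∈ range j, p i := by
    intro j hj
    rcases (hP0 j).eq_or_lt with h | h
    · have := hqp j hj
      rw [← h] at this ⊢
      simpa using this
    · exact (div_le_iff₀ h).1 (hmax j (by simpa using Nat.lt_succ_of_le hj))
  have heq : ∑ i ∈ range k, q i = ρ * ∑ i ∈ range k, p i := by
    rw [hρ, div_mul_cancel₀ _ hPk.ne']
  have hρR : ρ ≤ R := (div_le_iff₀ hPk).2 (hqp k hkn)
  obtain ⟨r, x, hr, hr0, hrρ, hx, hx0, hx0p, hrx, hxp, hqr, hg⟩ :=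
    ih (n - k) (by omega) (fun i => p (k + i)) (fun i => q (k + i)) ρ
      (fun i j h => hp (by omega)) (fun i j h => hq (by omega))
      (fun i => hp0 _) (fun i => hq0 _) hρ0.le (fun j hj => by
        have := hle (k + j) (by omega)
        rw [sum_range_add, sum_range_add, heq] at this
        linarith)
  let rr : ℕ → ℝ := fun i => if i < k then ρ else r (i - k)
  let xx : ℕ → ℝ := fun i => if i < k then q i / ρ else x (i - k)
  have hrl : ∀ i < k, rr i = ρ := fun i hi => if_pos hi
  have hrr : ∀ i, rr (k + i) = r i := fun i => by simp [rr]
  have hxl : ∀ i < k, xx i = q i / ρ := fun i hi => if_pos hi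
  have hxr : ∀ i, xx (k + i) = x i := fun i => by simp [xx]
  have sx : ∀ j ≤ k, ∑ i ∈ range j, xx i = (∑ i ∈ range j, q i) / ρ := fun j hj => by
    rw [sum_div]
    exact sum_congr rfl fun i hi => hxl i (by have := mem_range.1 hi; omega)
  have sr : ∀ j ≤ k, ∑ i ∈ range j, rr i * p i = ρ * ∑ i ∈ range j, p i := fun j hj => by
    rw [mul_sum]
    exact sum_congr rfl fun i hi => by rw [hrl i (by have := mem_range.1 hi; omega)]
  have sxk : ∑ i ∈ range k, xx i = ∑ i ∈ range k, p i := by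
    rw [sx k le_rfl, heq]; field_simp
  have sx1 : ∀ j ≤ k, ∑ i ∈ range j, xx i ≤ ∑ i ∈ range j, p i := fun j hj => by
    rw [sx j hj, div_le_iff₀ hρ0, mul_comm]
    exact hle j (by omega)
  have split : ∀ j ≤ n, j ≤ k ∨ ∃ l ≤ n - k, j = k + l := fun j hj => by
    rcases le_total j k with h | h
    · exact Or.inl h
    · exact Or.inr ⟨j - k, by omega, by omega⟩
  have hxk : ∀ i, x i ≤ p (k - 1) := fun i =>
    (hx (Nat.zero_le i)).trans (hx0p.trans (hp (by omega)))
  have hxk' : p (k - 1) ≤ q (k - 1) / ρ := by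
    have h1 := sx1 (k - 1) (by omega)
    have h2 := sxk
    obtain ⟨l, rfl⟩ : ∃ l, k = l + 1 := ⟨k - 1, by omega⟩
    rw [sum_range_succ, sum_range_succ, hxl l (by omega)] at h2
    simp only [Nat.add_sub_cancel] at *
    linarith
  refine ⟨rr, xx, ?_, ?_, ?_, ?_, ?_, ?_, ?_, ?_, ?_, ?_⟩
  · intro i j hij
    simp only [rr]
    split_ifs
    · exact le_rfl
    · omega
    · exact hrρ _
    · exact hr (by omega)
  · intro i
    simp only [rr]
    split_ifs
    · exact hρ0.le
    · exact hr0 _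
  · intro i
    simp only [rr]
    split_ifs
    · exact hρR
    · exact (hrρ _).trans hρR
  · intro i j hij
    simp only [xx]
    split_ifs
    · exact div_le_div_of_nonneg_right (hq hij) hρ0.le
    · omega
    · exact (hxk _).trans (hxk'.trans (div_le_div_of_nonneg_right (hq (by omega)) hρ0.le))
    · exact hx (by omega)
  · intro i
    simp only [xx]
    split_ifs
    · exact div_nonneg (hq0 i) hρ0.le
    · exact hx0 _
  · simpa using sx1 1 hk0
  · intro i hi
    simp only [rr, xx]
    split_ifs
    · field_simp
    · rw [hrx _ (by omega)]
      congr 1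
      omega
  · intro j hj
    rcases split j hj with h | ⟨l, hl, rfl⟩
    · exact sx1 j h
    · rw [sum_range_add, sum_range_add, sxk]
      simpa only [hxr] using add_le_add_right (hxp l hl) _
  · intro j hj
    rcases split j hj with h | ⟨l, hl, rfl⟩
    · rw [sr j h]
      exact hle j hj
    · rw [sum_range_add, sum_range_add, sr k le_rfl, heq]
      simpa only [hrr] using add_le_add_right (hqr l hl) _
  · intro g
    obtain ⟨l, rfl⟩ : ∃ l, n = k + l := ⟨n - k, by omega⟩
    have h1 : ∀ f : ℕ → ℝ, ∑ i ∈ range k, g (rr i) * f i = g ρ * ∑ i ∈ range k, f i := fun f => by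
      rw [mul_sum]
      exact sum_congr rfl fun i hi => by rw [hrl i (mem_range.1 hi)]
    have h2 := hg g
    rw [Nat.add_sub_cancel_left] at h2
    rw [sum_range_add, sum_range_add, h1, h1, sxk]
    simp only [hrr, hxr, h2]

theorem sum_le_sum_range_of_antitone {P : ℕ → ℝ} (hP : Antitone P) (s : Finset ℕ) :
    ∑ i ∈ s, P i ≤ ∑ i ∈ range s.card, P i := by
  induction s using Finset.induction_on_max with
  | empty => simp
  | insert a t ha ih =>
    have hat : a ∉ t := fun h => lt_irrefl _ (ha a h)
    have hc : t.card ≤ a := by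
      simpa using card_le_card (fun i hi => mem_range.2 (ha i hi) : t ⊆ range a)
    rw [sum_insert hat, card_insert_of_notMem hat, sum_range_succ]
    linarith [hP hc]

theorem kMaxSum_comp_perm {d : ℕ} (p : Fin d → ℝ) (σ : Equiv.Perm (Fin d)) (k : ℕ) :
    kMaxSum (p ∘ σ) k = kMaxSum p k := by
  have key : ∀ (p : Fin d → ℝ) (σ : Equiv.Perm (Fin d)), kMaxSum (p ∘ σ) k ≤ kMaxSum p k := by
    intro p σ
    refine sup'_le _ _ fun s hs => ?_
    have h1 : ∑ i ∈ s, (p ∘ σ) i = ∑ i ∈ s.map σ.toEmbedding, p i := by simp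
    rw [h1]
    exact le_sup' (fun s => ∑ i ∈ s, p i) (by simpa using hs)
  refine le_antisymm (key p σ) ?_
  simpa [Function.comp_assoc] using key (p ∘ σ) σ.symm

theorem isProbVec_comp_perm {d : ℕ} {p : Fin d → ℝ} (hp : IsProbVec p)
    (σ : Equiv.Perm (Fin d)) : IsProbVec (p ∘ σ) :=
  ⟨fun i => hp.1 _, by rw [← hp.2]; exact Equiv.sum_comp σ p⟩

theorem fidelity_comp_perm {d : ℕ} (p q : Fin d → ℝ) (σ : Equiv.Perm (Fin d)) :
    fidelity (p ∘ σ) (q ∘ σ) = fidelity p q := by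
  unfold fidelity
  congr 1
  exact Equiv.sum_comp σ fun i => Real.sqrt (p i * q i)

/-- Extension of a finite vector to a sequence by zeros. -/
def zeroExtend {d : ℕ} (p : Fin d → ℝ) (i : ℕ) : ℝ := if h : i < d then p ⟨i, h⟩ else 0

theorem zeroExtend_coe {d : ℕ} (p : Fin d → ℝ) (i : Fin d) : zeroExtend p i = p i := by
  simp [zeroExtend]

theorem zeroExtend_nonneg {d : ℕ} {p : Fin d → ℝ} (hp : ∀ i, 0 ≤ p i) (i : ℕ) :
    0 ≤ zeroExtend p i := by
  unfold zeroExtend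
  split_ifs
  · exact hp _
  · exact le_rfl

theorem antitone_zeroExtend {d : ℕ} {p : Fin d → ℝ} (hp : ∀ i, 0 ≤ p i) (ha : Antitone p) :
    Antitone (zeroExtend p) := by
  intro i j hij
  unfold zeroExtend
  split_ifs
  · exact ha (by simpa using hij)
  · omega
  · exact hp _
  · exact le_rfl

theorem sum_range_zeroExtend {d : ℕ} (p : Fin d → ℝ) :
    ∑ i ∈ range d, zeroExtend p i = ∑ i, p i := by
  rw [← Fin.sum_univ_eq_sum_range]
  simp only [zeroExtend_coe]

theorem kMaxSum_le_sum_range {d : ℕ} {p : Fin d → ℝ} {P : ℕ → ℝ} (hpP : ∀ i : Fin d, p i = P i)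
    (hP : Antitone P) (hP0 : ∀ i, 0 ≤ P i) (k : ℕ) : kMaxSum p k ≤ ∑ i ∈ range k, P i := by
  refine sup'_le _ _ fun s hs => ?_
  have hs' : s.card ≤ k := by simpa using hs
  have h1 : ∑ i ∈ s, p i = ∑ i ∈ s.map Fin.valEmbedding, P i := by simp [hpP]
  rw [h1]
  refine (sum_le_sum_range_of_antitone hP _).trans ?_
  exact sum_le_sum_of_subset_of_nonneg (range_subset_range.2 (by simpa using hs'))
    fun i _ _ => hP0 i

theorem sum_range_le_kMaxSum {d : ℕ} {p : Fin d → ℝ} {P : ℕ → ℝ} (hpP : ∀ i : Fin d, p i = P i)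
    {k : ℕ} (hk : k ≤ d) : ∑ i ∈ range k, P i ≤ kMaxSum p k := by
  have h1 : ∑ i ∈ range k, P i = ∑ i ∈ univ.map (Fin.castLEEmb hk), p i := by
    rw [sum_map, ← Fin.sum_univ_eq_sum_range]
    simp [hpP]
  rw [h1]
  exact le_sup' (fun s => ∑ i ∈ s, p i) (by simp)

theorem kMaxSum_of_dim_le {d : ℕ} {p : Fin d → ℝ} {k : ℕ} (hk : d ≤ k) :
    kMaxSum p k = kMaxSum p d := by
  unfold kMaxSum
  congr 1
  ext s
  have := card_finset_fin_le s
  simp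
  omega

/-- Majorisation of a sorted vector follows from domination of partial sums. -/
theorem majorises_of_sum_range_le {d : ℕ} {p q : Fin d → ℝ} {P Q : ℕ → ℝ}
    (hpP : ∀ i : Fin d, p i = P i) (hqQ : ∀ i : Fin d, q i = Q i)
    (hQ : Antitone Q) (hQ0 : ∀ i, 0 ≤ Q i)
    (h : ∀ j ≤ d, ∑ i ∈ range j, Q i ≤ ∑ i ∈ range j, P i) : Majorises p q := by
  have key : ∀ k ≤ d, kMaxSum q k ≤ kMaxSum p k := fun k hk =>
    (kMaxSum_le_sum_range hqQ hQ hQ0 k).trans ((h k hk).trans (sum_range_le_kMaxSum hpP hk))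
  intro k
  rcases le_total k d with hk | hk
  · exact key k hk
  · rw [kMaxSum_of_dim_le hk, kMaxSum_of_dim_le hk]
    exact key d le_rfl

theorem sum_range_le_of_majorises {d : ℕ} {p q : Fin d → ℝ} {P Q : ℕ → ℝ}
    (hpP : ∀ i : Fin d, p i = P i) (hqQ : ∀ i : Fin d, q i = Q i)
    (hP : Antitone P) (hP0 : ∀ i, 0 ≤ P i) (h : Majorises p q) :
    ∀ j ≤ d, ∑ i ∈ range j, Q i ≤ ∑ i ∈ range j, P i := fun j hj =>
  (sum_range_le_kMaxSum hqQ hj).trans ((h j).trans (kMaxSum_le_sum_range hpP hP hP0 j))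

theorem exists_perm_antitone_comp {d : ℕ} (y : Fin d → ℝ) :
    ∃ σ : Equiv.Perm (Fin d), Antitone (y ∘ σ) :=
  ⟨Tuple.sort (fun i => -y i), fun i j hij => by
    simpa using Tuple.monotone_sort (fun i => -y i) hij⟩

/-- Sorting the second vector like the first one does not decrease the fidelity. -/
theorem sum_sqrt_mul_le_sum_sqrt_mul_sort {d : ℕ} {p y : Fin d → ℝ} (hp : Antitone p)
    (hp0 : ∀ i, 0 ≤ p i) {σ : Equiv.Perm (Fin d)} (hσ : Antitone (y ∘ σ)) :
    ∑ i, √(p i * y i) ≤ ∑ i, √(p i * (y ∘ σ) i) := by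
  have h : Monovary (fun i => √(p i)) (fun i => √((y ∘ σ) i)) :=
    Antitone.monovary (fun i j hij => Real.sqrt_le_sqrt (hp hij))
      (fun i j hij => Real.sqrt_le_sqrt (hσ hij))
  have h1 := h.sum_mul_comp_perm_le_sum_mul (σ := σ.symm)
  simp only [Real.sqrt_mul (hp0 _)]
  simpa using h1

theorem sqrt_mul_le_half {a b s : ℝ} (ha : 0 ≤ a) (hb : 0 ≤ b) (hs : 0 ≤ s)
    (h : s = 0 → b = 0) : √(a * b) ≤ (s * a + b / s) / 2 := by
  rcases hs.eq_or_lt with h0 | h0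
  · simp [h h0.symm, ← h0]
  · have hbs : 0 ≤ b / s := div_nonneg hb hs
    have : a * b = (s * a) * (b / s) := by field_simp
    rw [this]
    refine Real.sqrt_le_iff.2 ⟨by positivity, ?_⟩
    nlinarith [sq_nonneg (s * a - b / s)]

/-- The upper bound for vectors `y` whose partial sums dominate those of `q`. -/
theorem sum_div_le_sum_div_of_dominating {n : ℕ} {s q y : ℕ → ℝ} (hs : Antitone s)
    (hs0 : ∀ i, 0 ≤ s i) (hy0 : ∀ i, 0 ≤ y i) (hq : ∀ i < n, s i = 0 → q i = 0)
    (htot : ∑ i ∈ range n, y i = ∑ i ∈ range n, q i)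
    (h : ∀ j ≤ n, ∑ i ∈ range j, q i ≤ ∑ i ∈ range j, y i) :
    (∀ i < n, s i = 0 → y i = 0) ∧
      ∑ i ∈ range n, y i / s i ≤ ∑ i ∈ range n, q i / s i := by
  have hpos : ∀ {i j}, i ≤ j → 0 < s j → 0 < s i := fun hij hj => hj.trans_le (hs hij)
  have hsupp : ∀ i < n, s i = 0 → y i = 0 := by
    have h1 := sum_mul_le_sum_mul_of_antitone (h := fun i => if 0 < s i then 1 else 0)
      (fun i j hij => by
        have := @hpos i j hij
        dsimp only
        split_ifs <;> simp_all) (fun i => by positivity) n h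
    have h2 : ∑ i ∈ range n, (if 0 < s i then (1 : ℝ) else 0) * q i = ∑ i ∈ range n, q i := by
      refine sum_congr rfl fun i hi => ?_
      rcases (hs0 i).eq_or_lt with h0 | h0
      · simp [hq i (mem_range.1 hi) h0.symm]
      · simp [h0]
    rw [h2, ← htot] at h1
    have h3 : ∀ i ∈ range n, (if 0 < s i then (1 : ℝ) else 0) * y i ≤ y i := fun i _ => by
      split_ifs <;> simp [hy0 i]
    have h4 := (sum_eq_sum_iff_of_le h3).1 (le_antisymm (sum_le_sum h3) h1)
    intro i hi h0
    simpa [h0] using (h4 i (mem_range.2 hi)).symm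
  refine ⟨hsupp, ?_⟩
  set C := ∑ i ∈ range n, 1 / s i with hC
  have hCi : ∀ i < n, 1 / s i ≤ C := fun i hi =>
    single_le_sum (f := fun i => 1 / s i) (fun i _ => one_div_nonneg.2 (hs0 i)) (mem_range.2 hi)
  have h1 := sum_mul_le_sum_mul_of_antitone
    (h := fun i => if 0 < s i then max (C - 1 / s i) 0 else 0)
    (fun i j hij => by
      have h1 := @hpos i j hij
      dsimp only
      split_ifs with hj hi hi
      · have := one_div_le_one_div_of_le hj (hs hij)
        exact max_le_max (by linarith) le_rfl
      · exact absurd (h1 hj) hi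
      · exact le_max_right _ _
      · exact le_rfl) (fun i => by split_ifs <;> simp) n h
  have h2 : ∀ z : ℕ → ℝ, (∀ i < n, s i = 0 → z i = 0) →
      ∑ i ∈ range n, (if 0 < s i then max (C - 1 / s i) 0 else 0) * z i =
        C * ∑ i ∈ range n, z i - ∑ i ∈ range n, z i / s i := by
    intro z hz
    rw [mul_sum, ← sum_sub_distrib]
    refine sum_congr rfl fun i hi => ?_
    rcases (hs0 i).eq_or_lt with h0 | h0
    · simp [hz i (mem_range.1 hi) h0.symm]
    · rw [if_pos h0, max_eq_left (sub_nonneg.2 (hCi i (mem_range.1 hi)))]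
      ring
  rw [h2 q hq, h2 y hsupp, htot] at h1
  linarith

/-- The duality for sorted vectors. -/
theorem exists_common_max_of_antitone {d : ℕ} (p q : Fin d → ℝ) (hp : IsProbVec p)
    (hq : IsProbVec q) (hpa : Antitone p) (hqa : Antitone q) :
    ∃ m : ℝ,
      IsGreatest {x : ℝ | ∃ pt : Fin d → ℝ,
        IsProbVec pt ∧ Majorises pt q ∧ x = fidelity p pt} m ∧
      IsGreatest {x : ℝ | ∃ qt : Fin d → ℝ,
        IsProbVec qt ∧ Majorises p qt ∧ x = fidelity q qt} m := by
  have hP0 := zeroExtend_nonneg hp.1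
  have hQ0 := zeroExtend_nonneg hq.1
  have hPa := antitone_zeroExtend hp.1 hpa
  have hQa := antitone_zeroExtend hq.1 hqa
  have hpP : ∀ i, p i = zeroExtend p i := fun i => (zeroExtend_coe p i).symm
  have hqQ : ∀ i, q i = zeroExtend q i := fun i => (zeroExtend_coe q i).symm
  have hP1 : ∑ i ∈ range d, zeroExtend p i = 1 := (sum_range_zeroExtend p).trans hp.2
  have hQ1 : ∑ i ∈ range d, zeroExtend q i = 1 := (sum_range_zeroExtend q).trans hq.2
  generalize zeroExtend p = P at *
  generalize zeroExtend q = Q at *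
  have hPpos : 0 < P 0 := by
    by_contra h
    have : ∑ i ∈ range d, P i ≤ 0 :=
      sum_nonpos fun i _ => (hPa (Nat.zero_le i)).trans (not_lt.1 h)
    linarith
  obtain ⟨r, x, hr, hr0, -, hx, hx0, -, hrx, hxP, hQr, hg⟩ :=
    exists_convex_minorant d P Q (1 / P 0) hPa hQa hP0 hQ0 (by positivity) (fun j hj => by
      rcases Nat.eq_zero_or_pos j with rfl | hj0
      · simp
      · have h1 : P 0 ≤ ∑ i ∈ range j, P i :=
          single_le_sum (fun i _ => hP0 i) (mem_range.2 hj0)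
        have h2 : ∑ i ∈ range j, Q i ≤ ∑ i ∈ range d, Q i :=
          sum_le_sum_of_subset_of_nonneg (range_subset_range.2 hj) fun i _ _ => hQ0 i
        rw [one_div, inv_mul_eq_div, le_div_iff₀ hPpos]
        nlinarith)
  have hs : Antitone fun i => √(r i) := fun i j hij => Real.sqrt_le_sqrt (hr hij)
  have hs0 : ∀ i, 0 ≤ √(r i) := fun i => Real.sqrt_nonneg _
  have hsq : ∀ i, √(r i) * √(r i) = r i := fun i => Real.mul_self_sqrt (hr0 i)
  have hsupp : ∀ i < d, √(r i) = 0 → Q i = 0 := fun i hi h => by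
    rw [← hrx i hi, ← hsq, h]; simp
  have hxdiv : ∀ i < d, Q i / √(r i) = √(r i) * x i := fun i hi => by
    rcases (hs0 i).eq_or_lt with h | h
    · simp [← h]
    · rw [div_eq_iff h.ne', ← hrx i hi]
      linear_combination -(x i) * hsq i
  set M := ∑ i ∈ range d, √(r i) * P i with hM
  have hM0 : 0 ≤ M := sum_nonneg fun i _ => mul_nonneg (hs0 i) (hP0 i)
  have hMx : ∑ i ∈ range d, √(r i) * x i = M := hg Real.sqrt
  have hMQ : ∑ i ∈ range d, Q i / √(r i) = M := by
    rw [← hMx]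
    exact sum_congr rfl fun i hi => hxdiv i (mem_range.1 hi)
  have hx1 : ∑ i ∈ range d, x i = 1 := by simpa [hP1] using hg fun _ => 1
  have hrP1 : ∑ i ∈ range d, r i * P i = 1 := by
    rw [← hQ1, ← hg fun t => t]
    exact sum_congr rfl fun i hi => hrx i (mem_range.1 hi)
  refine ⟨M ^ 2, ⟨⟨fun i => r i * P i, ⟨fun i => mul_nonneg (hr0 _) (hP0 _), ?_⟩, ?_, ?_⟩, ?_⟩,
    ⟨⟨fun i => x i, ⟨fun i => hx0 _, ?_⟩, ?_, ?_⟩, ?_⟩⟩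
  · rw [← hrP1, ← Fin.sum_univ_eq_sum_range]
  · exact majorises_of_sum_range_le (fun _ => rfl) hqQ hQa hQ0 hQr
  · unfold fidelity
    congr 1
    rw [hM, ← Fin.sum_univ_eq_sum_range]
    refine sum_congr rfl fun i _ => ?_
    rw [hpP, show P i * (r i * P i) = r i * (P i * P i) by ring, Real.sqrt_mul (hr0 _),
      Real.sqrt_mul_self (hP0 _)]
  · rintro _ ⟨y, hy, hyq, rfl⟩
    obtain ⟨σ, hσ⟩ := exists_perm_antitone_comp y
    have hz := isProbVec_comp_perm hy σ
    have hzq : Majorises (y ∘ σ) q := fun k => by rw [kMaxSum_comp_perm]; exact hyq k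
    refine pow_le_pow_left₀ (sum_nonneg fun i _ => Real.sqrt_nonneg _)
      ((sum_sqrt_mul_le_sum_sqrt_mul_sort hpa hp.1 hσ).trans ?_) 2
    have hzZ : ∀ i, (y ∘ σ) i = zeroExtend (y ∘ σ) i := fun i => (zeroExtend_coe _ i).symm
    have hZ0 := zeroExtend_nonneg hz.1
    have hZa := antitone_zeroExtend hz.1 hσ
    have hZ1 := (sum_range_zeroExtend (y ∘ σ)).trans hz.2
    generalize zeroExtend (y ∘ σ) = Z at *
    obtain ⟨h1, h2⟩ := sum_div_le_sum_div_of_dominating hs hs0 hZ0 hsupp (hZ1.trans hQ1.symm)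
      (sum_range_le_of_majorises hzZ hqQ hZa hZ0 hzq)
    calc ∑ i, √(p i * (y ∘ σ) i) = ∑ i ∈ range d, √(P i * Z i) := by
          rw [← Fin.sum_univ_eq_sum_range]
          simp only [hpP, hzZ]
      _ ≤ ∑ i ∈ range d, (√(r i) * P i + Z i / √(r i)) / 2 :=
          sum_le_sum fun i hi => sqrt_mul_le_half (hP0 i) (hZ0 i) (hs0 i) (h1 i (mem_range.1 hi))
      _ ≤ M := by
          rw [← sum_div, sum_add_distrib]
          linarith
  · rw [← hx1, ← Fin.sum_univ_eq_sum_range]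
  · exact majorises_of_sum_range_le hpP (fun _ => rfl) hx hx0 hxP
  · unfold fidelity
    congr 1
    rw [← hMx, ← Fin.sum_univ_eq_sum_range]
    refine sum_congr rfl fun i _ => ?_
    rw [hqQ, ← hrx i i.2, show r i * x i * x i = r i * (x i * x i) by ring,
      Real.sqrt_mul (hr0 _), Real.sqrt_mul_self (hx0 _)]
  · rintro _ ⟨y, hy, hyp, rfl⟩
    refine pow_le_pow_left₀ (sum_nonneg fun i _ => Real.sqrt_nonneg _) ?_ 2
    have hyY : ∀ i, y i = zeroExtend y i := fun i => (zeroExtend_coe _ i).symm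
    have hY0 := zeroExtend_nonneg hy.1
    generalize zeroExtend y = Y at *
    have h1 := sum_mul_le_sum_mul_of_antitone hs hs0 d
      (sum_range_le_of_majorises hpP hyY hPa hP0 hyp)
    calc ∑ i, √(q i * y i) = ∑ i ∈ range d, √(Y i * Q i) := by
          rw [← Fin.sum_univ_eq_sum_range]
          simp only [hqQ, hyY, mul_comm]
      _ ≤ ∑ i ∈ range d, (√(r i) * Y i + Q i / √(r i)) / 2 :=
          sum_le_sum fun i hi =>
            sqrt_mul_le_half (hY0 i) (hQ0 i) (hs0 i) (hsupp i (mem_range.1 hi))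
      _ ≤ M := by
          rw [← sum_div, sum_add_distrib]
          linarith

/-- the maximum fidelity `F(p,p̃)` over probability vectors `p̃ ≻ q`
equals the maximum fidelity `F(q,q̃)` over probability vectors `q̃` majorised by `p`,
and both maxima are attained. -/
theorem max_fidelity_majorising_eq_max_fidelity_majorised
    {d : ℕ} (p q : Fin d → ℝ) (hp : IsProbVec p) (hq : IsProbVec q) :
    ∃ m : ℝ,
      IsGreatest {x : ℝ | ∃ pt : Fin d → ℝ,
        IsProbVec pt ∧ Majorises pt q ∧ x = fidelity p pt} m ∧
      IsGreatest {x : ℝ | ∃ qt : Fin d → ℝ,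
        IsProbVec qt ∧ Majorises p qt ∧ x = fidelity q qt} m := by
  obtain ⟨σ, hσ⟩ := exists_perm_antitone_comp p
  obtain ⟨τ, hτ⟩ := exists_perm_antitone_comp q
  obtain ⟨m, hm1, hm2⟩ := exists_common_max_of_antitone (p ∘ σ) (q ∘ τ)
    (isProbVec_comp_perm hp σ) (isProbVec_comp_perm hq τ) hσ hτ
  refine ⟨m, ?_, ?_⟩
  · convert hm1 using 1
    ext v
    constructor
    · rintro ⟨y, hy, hyq, rfl⟩
      refine ⟨y ∘ σ, isProbVec_comp_perm hy σ, fun k => ?_, (fidelity_comp_perm p y σ).symm⟩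
      simpa only [kMaxSum_comp_perm] using hyq k
    · rintro ⟨y, hy, hyq, rfl⟩
      refine ⟨y ∘ σ.symm, isProbVec_comp_perm hy _, fun k => ?_, ?_⟩
      · simpa only [kMaxSum_comp_perm] using hyq k
      · rw [← fidelity_comp_perm p _ σ]
        simp [Function.comp_assoc]
  · convert hm2 using 1
    ext v
    constructor
    · rintro ⟨y, hy, hyp, rfl⟩
      refine ⟨y ∘ τ, isProbVec_comp_perm hy τ, fun k => ?_, (fidelity_comp_perm q y τ).symm⟩
      simpa only [kMaxSum_comp_perm] using hyp k
    · rintro ⟨y, hy, hyp, rfl⟩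
      refine ⟨y ∘ τ.symm, isProbVec_comp_perm hy _, fun k => ?_, ?_⟩
      · simpa only [kMaxSum_comp_perm] using hyp k
      · rw [← fidelity_comp_perm q _ τ]
        simp [Function.comp_assoc]
end
end

section
/- Post-majorisation between embedded vectors is equivalent to post-thermomajorisation between the original vectors: for probability vectors p, q ∈ ℝ^d and every ε ∈ [0,1], there exists a D-dimensional probability vector Q̃ with Γp ≻ Q̃ and δ(Γq, Q̃) ≤ ε if and only if there exists a d-dimensional probability vector q̃ with Γp ≻ Γq̃ and δ(q, q̃) ≤ ε. -/
open Finset Filter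

noncomputable section

/-- The embedding map `Γ`: given block sizes `Dc i` (with `∑ i, Dc i = D`) and a
block-assignment `blk : Fin D → Fin d` hitting each `i` exactly `Dc i` times,
`Γp` repeats the value `p i / Dc i` exactly `Dc i` times. -/
def embedMap {d D : ℕ} (Dc : Fin d → ℕ) (blk : Fin D → Fin d) (p : Fin d → ℝ) :
    Fin D → ℝ :=
  fun j => p (blk j) / (Dc (blk j) : ℝ)

theorem sum_le_kMaxSum {ι : Type*} [Fintype ι] (p : ι → ℝ) {k : ℕ} {s : Finset ι}
    (hs : s.card ≤ k) : ∑ i ∈ s, p i ≤ kMaxSum p k :=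
  Finset.le_sup' (fun s => ∑ i ∈ s, p i) (by simpa using hs)

/-- The vector of total weights of the blocks. -/
def blockSum {ι κ : Type*} [Fintype ι] [DecidableEq κ] (b : ι → κ) (Q : ι → ℝ) (i : κ) : ℝ :=
  ∑ j with b j = i, Q j

/-- The permutations that map every block to itself. -/
def blockPerms {ι κ : Type*} [Fintype ι] [DecidableEq ι] [DecidableEq κ] (b : ι → κ) :
    Finset (Equiv.Perm ι) :=
  {σ | ∀ j, b (σ j) = b j}

section Blocks

variable {ι κ : Type*} [Fintype ι] [DecidableEq ι] [DecidableEq κ] (b : ι → κ) (Q : ι → ℝ)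

theorem one_mem_blockPerms : (1 : Equiv.Perm ι) ∈ blockPerms b := by
  simp [blockPerms]

theorem sum_blockPerms_apply_eq {j j' : ι} (h : b j' = b j) :
    ∑ σ ∈ blockPerms b, Q (σ j') = ∑ σ ∈ blockPerms b, Q (σ j) := by
  have hsw : ∀ x, b (Equiv.swap j j' x) = b x := by
    intro x
    rw [Equiv.swap_apply_def]
    split_ifs with h1 h2
    · rw [h1, h]
    · rw [h2, h]
    · rfl
  have hmem : ∀ σ ∈ blockPerms b, σ * Equiv.swap j j' ∈ blockPerms b := by
    intro σ hσ
    simp only [blockPerms, mem_filter, mem_univ, true_and] at hσ ⊢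
    intro x
    rw [Equiv.Perm.mul_apply, hσ, hsw]
  refine Finset.sum_bij' (fun σ _ => σ * Equiv.swap j j') (fun σ _ => σ * Equiv.swap j j')
    hmem hmem ?_ ?_ ?_
  · intro σ _
    simp [mul_assoc]
  · intro σ _
    simp [mul_assoc]
  · intro σ _
    simp

theorem card_mul_sum_blockPerms_apply (j : ι) :
    (#{j' | b j' = b j} : ℝ) * ∑ σ ∈ blockPerms b, Q (σ j) =
      #(blockPerms b) * blockSum b Q (b j) := by
  have hinner : ∀ σ ∈ blockPerms b, ∑ j' with b j' = b j, Q (σ j') = blockSum b Q (b j) := by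
    intro σ hσ
    simp only [blockPerms, mem_filter, mem_univ, true_and] at hσ
    unfold blockSum
    refine Finset.sum_equiv σ ?_ ?_
    · intro x
      simp [hσ]
    · intro x _
      rfl
  calc (#{j' | b j' = b j} : ℝ) * ∑ σ ∈ blockPerms b, Q (σ j)
      = ∑ j' with b j' = b j, ∑ σ ∈ blockPerms b, Q (σ j') := by
        rw [← nsmul_eq_mul, ← Finset.sum_const]
        refine Finset.sum_congr rfl fun j' hj' => ?_
        exact (sum_blockPerms_apply_eq b Q (by simpa using hj')).symm
    _ = ∑ σ ∈ blockPerms b, ∑ j' with b j' = b j, Q (σ j') := Finset.sum_comm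
    _ = #(blockPerms b) * blockSum b Q (b j) := by
        rw [Finset.sum_congr rfl hinner, Finset.sum_const, nsmul_eq_mul]

/-- Replacing each entry by the average over its block yields a majorised vector. -/
theorem majorises_blockAverage :
    Majorises Q fun j => blockSum b Q (b j) / (#{j' | b j' = b j} : ℝ) := by
  intro k
  refine Finset.sup'_le _ _ fun s hs => ?_
  have hs : #s ≤ k := by simpa using hs
  have hG : (0 : ℝ) < #(blockPerms b) := by
    exact_mod_cast Finset.card_pos.2 ⟨1, one_mem_blockPerms b⟩
  have havg : ∀ j, #(blockPerms b) * (blockSum b Q (b j) / (#{j' | b j' = b j} : ℝ)) =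
      ∑ σ ∈ blockPerms b, Q (σ j) := by
    intro j
    have hc : (#{j' | b j' = b j} : ℝ) ≠ 0 := by
      exact_mod_cast (Finset.card_pos.2 ⟨j, by simp⟩).ne'
    rw [← mul_div_assoc, ← card_mul_sum_blockPerms_apply, mul_div_cancel_left₀ _ hc]
  refine le_of_mul_le_mul_left ?_ hG
  rw [Finset.mul_sum, Finset.sum_congr rfl fun j _ => havg j, Finset.sum_comm, ← nsmul_eq_mul]
  refine Finset.sum_le_card_nsmul _ _ _ fun σ _ => ?_
  have hmap : ∑ j ∈ s, Q (σ j) = ∑ j ∈ s.map σ.toEmbedding, Q j := by simp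
  rw [hmap]
  exact sum_le_kMaxSum Q (by simpa using hs)

end Blocks

theorem isProbVec_blockSum {ι κ : Type*} [Fintype ι] [Fintype κ] [DecidableEq κ] (b : ι → κ)
    {Q : ι → ℝ} (hQ : IsProbVec Q) : IsProbVec (blockSum b Q) := by
  refine ⟨fun i => Finset.sum_nonneg fun j _ => hQ.1 j, ?_⟩
  rw [← hQ.2]
  exact Finset.sum_fiberwise _ _ _

section Embedding

variable {d D : ℕ} {Dc : Fin d → ℕ} {blk : Fin D → Fin d}

theorem sum_comp_blk (hblk : ∀ i, #{j | blk j = i} = Dc i) (f : Fin d → ℝ) :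
    ∑ j, f (blk j) = ∑ i, Dc i * f i := by
  rw [← Finset.sum_fiberwise _ blk]
  refine Finset.sum_congr rfl fun i _ => ?_
  rw [← hblk i, ← nsmul_eq_mul]
  refine Finset.sum_eq_card_nsmul fun j hj => ?_
  rw [(Finset.mem_filter.1 hj).2]

theorem isProbVec_embedMap (hDc : ∀ i, 0 < Dc i)
    (hblk : ∀ i, #{j | blk j = i} = Dc i) {q : Fin d → ℝ} (hq : IsProbVec q) :
    IsProbVec (embedMap Dc blk q) := by
  refine ⟨fun j => div_nonneg (hq.1 _) (Nat.cast_nonneg _), ?_⟩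
  rw [← hq.2]
  refine (sum_comp_blk hblk fun i => q i / Dc i).trans (Finset.sum_congr rfl fun i _ => ?_)
  have := hDc i
  field_simp

theorem fidelity_embedMap (hDc : ∀ i, 0 < Dc i)
    (hblk : ∀ i, #{j | blk j = i} = Dc i) (q r : Fin d → ℝ) :
    fidelity (embedMap Dc blk q) (embedMap Dc blk r) = fidelity q r := by
  unfold fidelity
  congr 1
  refine (sum_comp_blk hblk fun i => √(q i / Dc i * (r i / Dc i))).trans
    (Finset.sum_congr rfl fun i _ => ?_)
  have := hDc i
  rw [div_mul_div_comm, Real.sqrt_div' _ (by positivity), Real.sqrt_mul_self (by positivity)]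
  field_simp

theorem fidelity_embedMap_le (hDc : ∀ i, 0 < Dc i)
    (hblk : ∀ i, #{j | blk j = i} = Dc i) {q : Fin d → ℝ} (hq : IsProbVec q) {Q : Fin D → ℝ}
    (hQ : IsProbVec Q) :
    fidelity (embedMap Dc blk q) Q ≤ fidelity q (blockSum blk Q) := by
  unfold fidelity
  refine pow_le_pow_left₀ (Finset.sum_nonneg fun _ _ => Real.sqrt_nonneg _) ?_ 2
  rw [← Finset.sum_fiberwise _ blk]
  refine Finset.sum_le_sum fun i _ => ?_
  have hi : (0 : ℝ) < Dc i := by exact_mod_cast hDc i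
  calc ∑ j with blk j = i, √(embedMap Dc blk q j * Q j)
      = ∑ j with blk j = i, √(q i / Dc i) * √(Q j) := by
        refine Finset.sum_congr rfl fun j hj => ?_
        rw [embedMap, (Finset.mem_filter.1 hj).2, Real.sqrt_mul (div_nonneg (hq.1 i) hi.le)]
    _ ≤ √(∑ j with blk j = i, q i / Dc i) * √(∑ j with blk j = i, Q j) :=
        Real.sum_sqrt_mul_sqrt_le _ (fun _ => div_nonneg (hq.1 i) hi.le) hQ.1
    _ = √(q i * blockSum blk Q i) := by
        rw [Finset.sum_const, hblk i, nsmul_eq_mul, mul_div_cancel₀ _ hi.ne',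
          Real.sqrt_mul (hq.1 i), blockSum]

end Embedding

/-- post-majorisation between embedded vectors is equivalent to
post-thermomajorisation between the original vectors. -/
theorem postMajorises_embedded_iff_postThermomajorises
    {d D : ℕ} (Dc : Fin d → ℕ) (hDc : ∀ i, 0 < Dc i) (hD : ∑ i, Dc i = D)
    (blk : Fin D → Fin d)
    (hblk : ∀ i, (Finset.univ.filter fun j => blk j = i).card = Dc i)
    (p q : Fin d → ℝ) (hp : IsProbVec p) (hq : IsProbVec q)
    (ε : ℝ) (hε : ε ∈ Set.Icc (0:ℝ) 1) :
    (∃ Qt : Fin D → ℝ, IsProbVec Qt ∧ Majorises (embedMap Dc blk p) Qt ∧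
        infid (embedMap Dc blk q) Qt ≤ ε) ↔
    (∃ qt : Fin d → ℝ, IsProbVec qt ∧
        Majorises (embedMap Dc blk p) (embedMap Dc blk qt) ∧ infid q qt ≤ ε) := by
  constructor
  · rintro ⟨Q, hQ, hmaj, hinf⟩
    refine ⟨blockSum blk Q, isProbVec_blockSum blk hQ, fun k => ?_, ?_⟩
    · have havg := majorises_blockAverage blk Q k
      simp only [hblk] at havg
      exact havg.trans (hmaj k)
    · exact (sub_le_sub_left (fidelity_embedMap_le hDc hblk hq hQ) 1).trans hinf
  · rintro ⟨r, hr, hmaj, hinf⟩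
    refine ⟨embedMap Dc blk r, isProbVec_embedMap hDc hblk hr, hmaj, ?_⟩
    rwa [infid, fidelity_embedMap hDc hblk]
end
end

section
/- Pre-majorisation of embedded vectors does not imply pre-thermomajorisation. Concretely, let γ = (3/4, 1/4), p = (1, 0), q = (1/2, 1/2), so that Γp = (1/3, 1/3, 1/3, 0) and Γq = (1/6, 1/6, 1/6, 1/2). Then: (i) the probability vector P̃ = (1/2, 1/4, 1/4, 0) satisfies P̃ ≻ Γq and δ(Γp, P̃) = (3 − 2√2)/6, so Γp ε₀-pre-majorises Γq with ε₀ = (3 − 2√2)/6; and (ii) the minimum over ε of those ε for which there exists a 2-dimensional probability vector p̃ with Γp̃ ≻ Γq and δ(p, p̃) ≤ ε equals 1/2, which is strictly greater than ε₀. -/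
open Finset Filter

noncomputable section

/-- The concrete embedding map for `γ = (3/4, 1/4)` (so `D₁ = 3`, `D₂ = 1`, `D = 4`):
`Γp = (p₁/3, p₁/3, p₁/3, p₂)`. -/
def Γ4 (p : Fin 2 → ℝ) : Fin 4 → ℝ := ![p 0 / 3, p 0 / 3, p 0 / 3, p 1]

theorem kMaxSum_le {ι : Type*} [Fintype ι] {p : ι → ℝ} {k : ℕ} {c : ℝ}
    (h : ∀ s : Finset ι, s.card ≤ k → ∑ i ∈ s, p i ≤ c) : kMaxSum p k ≤ c :=
  Finset.sup'_le _ _ fun s hs => h s (by simpa using hs)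

theorem majorises_half_quarter_quarter :
    Majorises (![1/2, 1/4, 1/4, 0] : Fin 4 → ℝ) (Γ4 ![1/2, 1/2]) := by
  intro k
  refine kMaxSum_le fun s hs => ?_
  have hnonneg : ∀ i, 0 ≤ Γ4 ![1/2, 1/2] i := by
    intro i
    fin_cases i <;> norm_num [Γ4]
  have hmin : ∀ i, Γ4 ![1/2, 1/2] i ≤ 1/6 + if i = 3 then 1/3 else 0 := by
    intro i
    fin_cases i <;> simp [Γ4] <;> norm_num
  have hcard : ∑ i ∈ s, Γ4 ![1/2, 1/2] i ≤ s.card / 6 + 1/3 := by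
    calc ∑ i ∈ s, Γ4 ![1/2, 1/2] i
        ≤ ∑ i ∈ s, ((1/6 : ℝ) + if i = 3 then 1/3 else 0) :=
          Finset.sum_le_sum fun i _ => hmin i
      _ ≤ s.card / 6 + 1/3 := by
          rw [Finset.sum_add_distrib, Finset.sum_ite_eq', Finset.sum_const, nsmul_eq_mul]
          split_ifs <;> linarith
  have hone : ∑ i ∈ s, Γ4 ![1/2, 1/2] i ≤ 1 := by
    refine (Finset.sum_le_univ_sum_of_nonneg hnonneg).trans ?_
    simp only [Γ4, Fin.sum_univ_four, Matrix.cons_val]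
    norm_num
  obtain h0 | h1 | h2 | h3 : s.card = 0 ∨ s.card = 1 ∨ s.card = 2 ∨ 3 ≤ s.card := by omega
  · refine le_trans ?_ (sum_le_kMaxSum (s := ∅) _ (by simp))
    simp [Finset.card_eq_zero.mp h0]
  · refine le_trans ?_ (sum_le_kMaxSum (s := {0}) _ (by simp; omega))
    rw [h1] at hcard
    norm_num at hcard ⊢
    linarith
  · refine le_trans ?_ (sum_le_kMaxSum (s := {0, 1}) _ (by simp; omega))
    rw [h2] at hcard
    norm_num at hcard ⊢
    linarith
  · refine le_trans ?_ (sum_le_kMaxSum (s := {0, 1, 2}) _ (by simp; omega))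
    refine hone.trans ?_
    rw [Finset.sum_insert (by decide), Finset.sum_insert (by decide), Finset.sum_singleton]
    simp only [Matrix.cons_val]
    norm_num

theorem infid_uniform_half_quarter_quarter :
    infid (Γ4 ![1, 0]) ![1/2, 1/4, 1/4, 0] = (3 - 2 * Real.sqrt 2) / 6 := by
  have hsqrt : Real.sqrt (1/6) = Real.sqrt 2 * Real.sqrt (1/12) := by
    rw [← Real.sqrt_mul (by norm_num)]
    norm_num
  have h2 : Real.sqrt 2 ^ 2 = 2 := Real.sq_sqrt (by norm_num)
  have h12 : Real.sqrt (1/12) ^ 2 = 1/12 := Real.sq_sqrt (by norm_num)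
  have hsum : ∑ i, Real.sqrt (Γ4 ![1, 0] i * (![1/2, 1/4, 1/4, 0] : Fin 4 → ℝ) i)
      = Real.sqrt (1/6) + Real.sqrt (1/12) + Real.sqrt (1/12) := by
    rw [Fin.sum_univ_four]
    have e0 : Γ4 ![1, 0] 0 * (![1/2, 1/4, 1/4, 0] : Fin 4 → ℝ) 0 = 1/6 := by norm_num [Γ4]
    have e1 : Γ4 ![1, 0] 1 * (![1/2, 1/4, 1/4, 0] : Fin 4 → ℝ) 1 = 1/12 := by norm_num [Γ4]
    have e2 : Γ4 ![1, 0] 2 * (![1/2, 1/4, 1/4, 0] : Fin 4 → ℝ) 2 = 1/12 := by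
      simp only [Γ4, Matrix.cons_val]
      norm_num
    have e3 : Γ4 ![1, 0] 3 * (![1/2, 1/4, 1/4, 0] : Fin 4 → ℝ) 3 = 0 := by
      simp only [Γ4, Matrix.cons_val]
      norm_num
    rw [e0, e1, e2, e3, Real.sqrt_zero, add_zero]
  rw [infid, fidelity, hsum, hsqrt]
  linear_combination (-(Real.sqrt 2 + 2) ^ 2) * h12 - (1/12) * h2

theorem infid_one_zero {r : Fin 2 → ℝ} (hr : 0 ≤ r 0) : infid ![1, 0] r = 1 - r 0 := by
  simp [infid, fidelity, Fin.sum_univ_two, Real.sq_sqrt hr]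

theorem half_le_snd_of_majorises {r : Fin 2 → ℝ} (hr : IsProbVec r)
    (hmaj : Majorises (Γ4 r) (Γ4 ![1/2, 1/2])) : 1/2 ≤ r 1 := by
  obtain ⟨hnonneg, hsum⟩ := hr
  rw [Fin.sum_univ_two] at hsum
  have h0 := hnonneg 0
  have h1 := hnonneg 1
  by_contra! hlt
  have hlower : 1/2 ≤ kMaxSum (Γ4 ![1/2, 1/2]) 1 := by
    refine le_trans ?_ (sum_le_kMaxSum (s := {3}) _ (by simp))
    simp [Γ4]
  have hupper : kMaxSum (Γ4 r) 1 ≤ max (r 0 / 3) (r 1) := by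
    refine kMaxSum_le fun s hs => ?_
    obtain ⟨i, hi⟩ := Finset.card_le_one_iff_subset_singleton.mp hs
    obtain rfl | rfl := Finset.subset_singleton_iff.mp hi
    · simp [h1]
    · rw [Finset.sum_singleton]
      fin_cases i <;> simp [Γ4]
  have hmax : max (r 0 / 3) (r 1) < 1/2 := max_lt (by linarith) hlt
  linarith [hmaj 1]

/-- pre-majorisation of embedded vectors does not imply
pre-thermomajorisation: with `p = (1,0)`, `q = (1/2,1/2)` and `γ = (3/4,1/4)`,
the vector `P̃ = (1/2,1/4,1/4,0)` majorises `Γq` with `δ(Γp,P̃) = (3-2√2)/6 = ε₀`,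
while the minimal `ε` admitting a 2-dimensional probability vector `p̃` with
`Γp̃ ≻ Γq` and `δ(p,p̃) ≤ ε` equals `1/2 > ε₀`. -/
theorem preMajorises_embedded_not_implies_preThermomajorises :
    let p : Fin 2 → ℝ := ![1, 0]
    let q : Fin 2 → ℝ := ![1/2, 1/2]
    let Pt : Fin 4 → ℝ := ![1/2, 1/4, 1/4, 0]
    IsProbVec Pt ∧
    Majorises Pt (Γ4 q) ∧
    infid (Γ4 p) Pt = (3 - 2 * Real.sqrt 2) / 6 ∧
    IsLeast {ε : ℝ | ∃ pt : Fin 2 → ℝ, IsProbVec pt ∧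
        Majorises (Γ4 pt) (Γ4 q) ∧ infid p pt ≤ ε} (1/2) ∧
    (3 - 2 * Real.sqrt 2) / 6 < (1/2 : ℝ) := by
  intro p q Pt
  refine ⟨⟨?_, ?_⟩, majorises_half_quarter_quarter, infid_uniform_half_quarter_quarter,
    ⟨⟨q, ⟨?_, ?_⟩, fun _ => le_rfl, ?_⟩, ?_⟩, ?_⟩
  · intro i
    fin_cases i <;> norm_num [Pt]
  · simp only [Pt, Fin.sum_univ_four, Matrix.cons_val]
    norm_num
  · intro i
    fin_cases i <;> norm_num [q]
  · norm_num [q, Fin.sum_univ_two]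
  · rw [infid_one_zero (by norm_num [q])]
    norm_num [q]
  · rintro ε ⟨r, hr, hmaj, hε⟩
    rw [infid_one_zero (hr.1 0)] at hε
    have hhalf := half_le_snd_of_majorises hr hmaj
    have hsum := hr.2
    rw [Fin.sum_univ_two] at hsum
    linarith
  · have : 0 < Real.sqrt 2 := Real.sqrt_pos.mpr (by norm_num)
    linarith
end
end

section
/- Central limit tail bound (magnitude form): let a be a probability vector of dimension d with V(a) > 0, and for x ∈ ℝ set k_n(x) := ⌊exp(n·H(a) + x·√(n·V(a)))⌋. Then for every x ∈ ℝ, the total mass of those entries of the n-fold tensor power a^{⊗n} that are at least 1/k_n(x) converges, as n → ∞, to Φ(x); that is, lim_{n→∞} Σ_i { (a^{⊗n})_i : (a^{⊗n})_i ≥ 1/k_n(x) } = Φ(x). -/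
open Finset Filter

noncomputable section

/-- The `n`-fold tensor (Kronecker) power of `a`, as a vector indexed by
`Fin n → Fin d` (a probability vector of dimension `d^n`). -/
def tensorPow {d : ℕ} (a : Fin d → ℝ) (n : ℕ) : (Fin n → Fin d) → ℝ :=
  fun f => ∏ j, a (f j)

/-- Shannon entropy `H(p) = -Σ_i p_i log p_i`. -/
def shannonH {ι : Type*} [Fintype ι] (p : ι → ℝ) : ℝ := -∑ i, p i * Real.log (p i)

/-- Entropy variance `V(p) = Σ_i p_i (-log p_i - H(p))²`. -/
def entVar {ι : Type*} [Fintype ι] (p : ι → ℝ) : ℝ :=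
  ∑ i, p i * (-Real.log (p i) - shannonH p) ^ 2

/-- Relative entropy to the uniform distribution: `D(p) = log d - H(p)`. -/
def relD {d : ℕ} (p : Fin d → ℝ) : ℝ := Real.log d - shannonH p

/-- Density of the normal distribution with mean `μ` and variance `v`. -/
def normPDF (μ v x : ℝ) : ℝ :=
  Real.exp (-((x - μ) ^ 2) / (2 * v)) / Real.sqrt (2 * Real.pi * v)

/-- Cumulative distribution function `Φ_{μ,v}` of the normal distribution. -/
def normCDF (μ v x : ℝ) : ℝ := ∫ t in Set.Iic x, normPDF μ v t

/-- The standard normal cumulative distribution function `Φ`. -/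
def Phi (x : ℝ) : ℝ := normCDF 0 1 x
open MeasureTheory ProbabilityTheory Topology

lemma Phi_eq_gaussianReal_Iic (x : ℝ) : Phi x = (gaussianReal 0 1).real (Set.Iic x) := by
  rw [measureReal_def, gaussianReal_apply_eq_integral _ one_ne_zero, ENNReal.toReal_ofReal
    (integral_nonneg fun t => gaussianPDFReal_nonneg _ _ _), Phi, normCDF]
  congr with t
  simp [normPDF, gaussianPDFReal, div_eq_inv_mul]

/-- Convergence in distribution to a standard Gaussian, evaluated at converging thresholds. -/
lemma tendsto_real_le_of_tendstoInDistribution {Ω : Type*} [MeasurableSpace Ω] {P : Measure Ω}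
    [IsProbabilityMeasure P] {S : ℕ → Ω → ℝ} {y : ℕ → ℝ} {x : ℝ}
    (hS : TendstoInDistribution S atTop id (fun _ => P) (gaussianReal 0 1))
    (hy : Tendsto y atTop (𝓝 x)) :
    Tendsto (fun n => P.real {ω | S n ω ≤ y n}) atTop (𝓝 (Phi x)) := by
  have hc : TendstoInMeasure P (fun n (_ : Ω) => x - y n) atTop (fun _ => (0 : ℝ)) :=
    tendstoInMeasure_of_tendsto_ae (fun _ => aestronglyMeasurable_const)
      (ae_of_all _ fun _ => by simpa using hy.const_sub x)
  have h := hS.add_of_tendstoInMeasure_const hc (fun _ => aemeasurable_const)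
  have hφ : ((gaussianReal 0 1).map fun ω : ℝ => id ω + (0 : ℝ)) = gaussianReal 0 1 := by
    simp
  have hfr : (gaussianReal 0 1) (frontier (Set.Iic x)) = 0 := by
    have := nullSingletonClass_gaussianReal (μ := 0) (v := 1) one_ne_zero
    simp
  have key := ProbabilityMeasure.tendsto_measure_of_null_frontier_of_tendsto' h.tendsto
    (E := Set.Iic x) (by simpa [hφ] using hfr)
  have key' := (ENNReal.tendsto_toReal (by simp)).comp key
  rw [Phi_eq_gaussianReal_Iic]
  convert! key' using 2 with n
  · simp only [Function.comp_apply, ProbabilityMeasure.coe_mk, measureReal_def]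
    rw [Measure.map_apply_of_aemeasurable (h.forall_aemeasurable n) measurableSet_Iic]
    congr 2
    ext ω
    simp only [Set.mem_ofPred_eq, Set.mem_preimage, Set.mem_Iic, Pi.add_apply]
    constructor <;> intro <;> linarith
  · simp [measureReal_def]

lemma shannonH_pos {ι : Type*} [Fintype ι] {p : ι → ℝ} (hp : IsProbVec p) (hV : 0 < entVar p) :
    0 < shannonH p := by
  have hle : ∀ i, p i ≤ 1 := fun i =>
    hp.2 ▸ single_le_sum (fun j _ => hp.1 j) (mem_univ i)
  have hterm : ∀ i ∈ univ, 0 ≤ -(p i * Real.log (p i)) := fun i _ =>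
    neg_nonneg.2 (mul_nonpos_of_nonneg_of_nonpos (hp.1 i) (Real.log_nonpos (hp.1 i) (hle i)))
  have hH : shannonH p = ∑ i, -(p i * Real.log (p i)) := by simp [shannonH]
  refine lt_of_le_of_ne (hH ▸ sum_nonneg hterm) fun h0 => hV.ne' ?_
  have hz := (sum_eq_zero_iff_of_nonneg hterm).1 (hH ▸ h0.symm)
  refine sum_eq_zero fun i hi => ?_
  rw [← h0]
  linear_combination (-Real.log (p i)) * hz i hi

/-- Rounding down `exp (n h + x √(n v))` does not affect the normalised threshold in the limit. -/
lemma tendsto_log_floor_sub_div_sqrt {h v : ℝ} (hh : 0 < h) (hv : 0 < v) (x : ℝ) :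
    Tendsto (fun n : ℕ => (Real.log (⌊Real.exp (n * h + x * √(n * v))⌋₊ : ℕ) - n * h) / √(n * v))
      atTop (𝓝 x) ∧
    Tendsto (fun n : ℕ => ⌊Real.exp (n * h + x * √(n * v))⌋₊) atTop atTop := by
  have hs : Tendsto (fun n : ℕ => √(n : ℝ)) atTop atTop :=
    Real.tendsto_sqrt_atTop.comp tendsto_natCast_atTop_atTop
  have hE : Tendsto (fun n : ℕ => Real.exp (n * h + x * √(n * v))) atTop atTop := by
    refine Real.tendsto_exp_atTop.comp ?_
    have : Tendsto (fun n : ℕ => √(n : ℝ) * (√(n : ℝ) * h + x * √v)) atTop atTop :=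
      hs.atTop_mul_atTop₀ (tendsto_atTop_add_const_right _ _ (hs.atTop_mul_const hh))
    refine this.congr fun n => ?_
    rw [Real.sqrt_mul n.cast_nonneg]
    linear_combination h * Real.mul_self_sqrt (n.cast_nonneg (α := ℝ))
  have hk := tendsto_nat_floor_atTop.comp hE
  refine ⟨?_, hk⟩
  have hlog := (Real.continuousAt_log one_ne_zero).tendsto.comp
    ((tendsto_nat_floor_div_atTop (R := ℝ)).comp hE)
  have hinv : Tendsto (fun n : ℕ => (√(n * v))⁻¹) atTop (𝓝 0) :=
    tendsto_inv_atTop_zero.comp (Real.tendsto_sqrt_atTop.comp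
      (tendsto_natCast_atTop_atTop.atTop_mul_const hv))
  have hlim := (hlog.mul hinv).add_const x
  rw [mul_zero, zero_add] at hlim
  refine hlim.congr' ?_
  filter_upwards [hk.eventually_ge_atTop 1, eventually_ge_atTop 1] with n hn hn1
  have hn1' : (0 : ℝ) < n := by exact_mod_cast hn1
  have hsq : √(n * v) ≠ 0 := (Real.sqrt_pos.2 (mul_pos hn1' hv)).ne'
  have hk0 : ((⌊Real.exp (n * h + x * √(n * v))⌋₊ : ℕ) : ℝ) ≠ 0 := by
    exact_mod_cast (Nat.one_le_iff_ne_zero.1 hn)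
  simp only [Function.comp_apply]
  rw [Real.log_div hk0 (Real.exp_ne_zero _), Real.log_exp]
  field_simp
  ring

/-- A probability vector as a probability mass function. -/
def IsProbVec.toPMF {ι : Type*} [Fintype ι] {p : ι → ℝ} (hp : IsProbVec p) : PMF ι :=
  PMF.ofFintype (fun i => ENNReal.ofReal (p i)) (by
    rw [← ENNReal.ofReal_sum_of_nonneg fun i _ => hp.1 i, hp.2, ENNReal.ofReal_one])

lemma IsProbVec.toPMF_apply {ι : Type*} [Fintype ι] {p : ι → ℝ} (hp : IsProbVec p) (i : ι) :
    hp.toPMF i = ENNReal.ofReal (p i) := rfl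

/-- Integration against the probability mass function of a probability vector. -/
lemma IsProbVec.integral_toPMF {ι : Type*} [Fintype ι] [MeasurableSpace ι]
    [MeasurableSingletonClass ι] {p : ι → ℝ} (hp : IsProbVec p) (g : ι → ℝ) :
    ∫ i, g i ∂hp.toPMF.toMeasure = ∑ i, p i * g i := by
  simp [PMF.integral_eq_sum, hp.toPMF_apply, ENNReal.toReal_ofReal (hp.1 _)]

open scoped Classical in
/-- The first `n` coordinates of an i.i.d. sequence with law `a` are distributed as `a^{⊗n}`. -/
lemma infinitePi_real_setOf_eq_sum_tensorPow {d : ℕ} {a : Fin d → ℝ} (ha : IsProbVec a) (n : ℕ)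
    (q : (Fin n → Fin d) → Prop) :
    (Measure.infinitePi fun _ : ℕ => ha.toPMF.toMeasure).real {ω | q fun i : Fin n => ω i} =
      ∑ f ∈ univ.filter q, tensorPow a n f := by
  have hmap : (Measure.infinitePi fun _ : ℕ => ha.toPMF.toMeasure).map
      (fun ω (i : Fin n) => ω i) = Measure.pi fun _ : Fin n => ha.toPMF.toMeasure := by
    rw [Measure.map_infinitePi_infinitePi_of_inj (P := fun _ : ℕ => ha.toPMF.toMeasure)
      Fin.val_injective, Measure.infinitePi_eq_pi]
  have hset : {ω : ℕ → Fin d | q fun i : Fin n => ω i} =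
      (fun ω (i : Fin n) => ω i) ⁻¹' (univ.filter q : Finset (Fin n → Fin d)) := by
    ext; simp
  rw [hset, ← map_measureReal_apply (by fun_prop) (Finset.measurableSet _), hmap,
    ← sum_measureReal_singleton]
  refine sum_congr rfl fun f _ => ?_
  simp [measureReal_def, Measure.pi_singleton, ha.toPMF_apply,
    ENNReal.toReal_prod, ENNReal.toReal_ofReal (ha.1 _), tensorPow]

/-- The central limit theorem for the log-likelihoods of an i.i.d. sequence with law `a`. -/
lemma tendstoInDistribution_log_sub_shannonH {d : ℕ} {a : Fin d → ℝ} (ha : IsProbVec a)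
    (hV : 0 < entVar a) :
    TendstoInDistribution (fun (n : ℕ) (ω : ℕ → Fin d) => (√n)⁻¹ *
        ∑ k ∈ range n, (-Real.log (a (ω k)) - shannonH a) / √(entVar a))
      atTop id (fun _ => Measure.infinitePi fun _ : ℕ => ha.toPMF.toMeasure)
      (gaussianReal 0 1) := by
  set μ := ha.toPMF.toMeasure
  set g : Fin d → ℝ := fun j => (-Real.log (a j) - shannonH a) / √(entVar a) with hg
  have hgm : Measurable g := measurable_of_finite g
  have heval (k : ℕ) := measurePreserving_eval_infinitePi (fun _ : ℕ => μ) k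
  have hint (u : Fin d → ℝ) :
      ∫ ω, u (ω 0) ∂(Measure.infinitePi fun _ : ℕ => μ) = ∑ j, a j * u j := by
    rw [← ha.integral_toPMF u]
    have := integral_map (heval 0).aemeasurable (measurable_of_finite u).aestronglyMeasurable
    rw [(heval 0).map_eq] at this
    exact this.symm
  refine tendstoInDistribution_inv_sqrt_mul_sum (X := fun k (ω : ℕ → Fin d) => g (ω k))
    HasLaw.id ?_ ?_ ?_ ?_
  · rw [hint g]
    have : ∑ j, a j * (-Real.log (a j) - shannonH a) = 0 := by
      simp only [mul_sub, sum_sub_distrib, ← sum_mul, ha.2, mul_neg, sum_neg_distrib, shannonH]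
      ring
    simp only [hg, mul_div_assoc', ← sum_div, this, zero_div]
  · refine (hint fun j => g j ^ 2).trans ?_
    simp only [hg, div_pow, Real.sq_sqrt hV.le, mul_div_assoc', ← sum_div]
    exact div_self hV.ne'
  · exact iIndepFun_infinitePi (X := fun _ => g) fun _ => hgm
  · intro k
    exact (IdentDistrib.mk (heval k).aemeasurable (heval 0).aemeasurable
      ((heval k).map_eq.trans (heval 0).map_eq.symm)).comp hgm

lemma one_div_le_tensorPow_iff {d : ℕ} {a : Fin d → ℝ} (hV : 0 < entVar a) {n : ℕ} (hn : 0 < n)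
    {k : ℝ} (hk : 0 < k) {f : Fin n → Fin d} (hf : ∀ i, 0 < a (f i)) :
    1 / k ≤ tensorPow a n f ↔
      (√n)⁻¹ * ∑ i, (-Real.log (a (f i)) - shannonH a) / √(entVar a) ≤
        (Real.log k - n * shannonH a) / √(n * entVar a) := by
  have hn' : (0 : ℝ) < n := by exact_mod_cast hn
  have hsum : (√n)⁻¹ * ∑ i, (-Real.log (a (f i)) - shannonH a) / √(entVar a) =
      (-∑ i, Real.log (a (f i)) - n * shannonH a) / √(n * entVar a) := by
    rw [← sum_div, sum_sub_distrib, Real.sqrt_mul hn'.le, sum_neg_distrib]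
    simp only [sum_const, card_univ, Fintype.card_fin, nsmul_eq_mul]
    field_simp
  rw [hsum, div_le_div_iff_of_pos_right (Real.sqrt_pos.2 (mul_pos hn' hV)),
    tensorPow, ← Real.log_le_log_iff (by positivity) (prod_pos fun i _ => hf i),
    Real.log_prod fun i _ => (hf i).ne', one_div, Real.log_inv]
  constructor <;> intro <;> linarith

open scoped Classical in
/-- central limit tail bound (magnitude form): the total mass of the
entries of `a^{⊗n}` of magnitude at least `1/k_n(x)` converges to `Φ(x)`, where
`k_n(x) = ⌊exp(n H(a) + x √(n V(a)))⌋`. -/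
theorem clt_tail_magnitude
    {d : ℕ} (a : Fin d → ℝ) (ha : IsProbVec a) (hV : 0 < entVar a) (x : ℝ) :
    Filter.Tendsto (fun n : ℕ =>
      ∑ f ∈ Finset.univ.filter (fun f : Fin n → Fin d =>
          1 / ((⌊Real.exp (n * shannonH a + x * Real.sqrt (n * entVar a))⌋₊ : ℕ) : ℝ)
            ≤ tensorPow a n f),
        tensorPow a n f)
      Filter.atTop (nhds (Phi x)) := by
  obtain ⟨hy, hk⟩ := tendsto_log_floor_sub_div_sqrt (shannonH_pos ha hV) hV x
  refine (tendsto_real_le_of_tendstoInDistribution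
    (tendstoInDistribution_log_sub_shannonH ha hV) hy).congr' ?_
  filter_upwards [hk.eventually_ge_atTop 1, eventually_ge_atTop 1] with n hk1 hn
  set k := ⌊Real.exp (n * shannonH a + x * √(n * entVar a))⌋₊
  have hk0 : (0 : ℝ) < k := by exact_mod_cast hk1
  simp only [Finset.sum_range]
  rw [infinitePi_real_setOf_eq_sum_tensorPow ha n fun f =>
    (√n)⁻¹ * ∑ i, (-Real.log (a (f i)) - shannonH a) / √(entVar a) ≤
      (Real.log k - n * shannonH a) / √(n * entVar a), sum_filter, sum_filter]
  refine sum_congr rfl fun f _ => ?_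
  by_cases hf : ∀ i, 0 < a (f i)
  · simp only [one_div_le_tensorPow_iff hV hn hk0 hf]
  · push Not at hf
    obtain ⟨i, hi⟩ := hf
    have hzero : tensorPow a n f = 0 := prod_eq_zero (mem_univ i) (hi.antisymm (ha.1 _))
    simp [hzero]
end
end
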